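/- arXiv:1709.02377 — 2 statements merged into one kernel-verified Lean document; each statement's English description precedes it below -/
import Mathlib

section
/- Let g : ℤ → ℤ be a grouping function, let S be a finite nonempty multiset of integers, let k ∈ {1,…,|S|}, and set q = select_{g⟦S⟧}(k). Then select_S(k) = select_{S ∩ g⁻¹(q)}(k − rank_{g⟦S⟧}(q − 1)), and in particular 1 ≤ k − rank_{g⟦S⟧}(q − 1) ≤ |S ∩ g⁻¹(q)|, so the right-hand side is well defined. -/
/-- `mrank S j` is the rank of `j` in the multiset `S` of integers:
the number of elements of `S` (counted with multiplicity) that are at most `j`. -/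
def mrank (S : Multiset ℤ) (j : ℤ) : ℕ := (S.filter (· ≤ j)).card

/-- `mselect S k` is the select operation: the least `j : ℤ` with `k ≤ mrank S j`. -/
noncomputable def mselect (S : Multiset ℤ) (k : ℤ) : ℤ := sInf {j : ℤ | k ≤ (mrank S j : ℤ)}

/-- `srank A j` is the rank of `j` in the (simple) set `A` of integers. -/
noncomputable def srank (A : Set ℤ) (j : ℤ) : ℕ := {i ∈ A | i ≤ j}.ncard

/-- `sselect A k` is the select operation for a set of integers. -/
noncomputable def sselect (A : Set ℤ) (k : ℤ) : ℤ := sInf {j : ℤ | k ≤ (srank A j : ℤ)}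

/-- The support `⟨S⟩` of a multiset of integers, as a set. -/
def msupp (S : Multiset ℤ) : Set ℤ := {x | x ∈ S}

/-- `rank_S(ℤ)`: the image of the function `mrank S`, as a set of integers. -/
def rankImage (S : Multiset ℤ) : Set ℤ := Set.range fun j : ℤ => (mrank S j : ℤ)

/-- A grouping function: a nondecreasing `g : ℤ → ℤ` all of whose fibers are finite. -/
def GroupingFunction (g : ℤ → ℤ) : Prop := Monotone g ∧ ∀ q : ℤ, (g ⁻¹' {q}).Finite


theorem mrank_cons (a : ℤ) (S : Multiset ℤ) (j : ℤ) :
    mrank (a ::ₘ S) j = mrank S j + if a ≤ j then 1 else 0 := by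
  unfold mrank
  split_ifs with h <;> simp [h]

theorem isLeast_mselect {S : Multiset ℤ} {k : ℤ} (hk1 : 1 ≤ k)
    (hk2 : k ≤ (Multiset.card S : ℤ)) :
    IsLeast {j : ℤ | k ≤ (mrank S j : ℤ)} (mselect S k) := by
  obtain ⟨M, hM⟩ := S.toFinset.bddAbove
  obtain ⟨m, hm⟩ := S.toFinset.bddBelow
  have hne : {j : ℤ | k ≤ (mrank S j : ℤ)}.Nonempty := by
    refine ⟨M, ?_⟩
    have : S.filter (· ≤ M) = S :=
      Multiset.filter_eq_self.2 fun x hx => hM (by simpa using hx)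
    simpa [mrank, this] using hk2
  have hbdd : BddBelow {j : ℤ | k ≤ (mrank S j : ℤ)} := by
    refine ⟨m, fun j hj => ?_⟩
    have hpos : 0 < mrank S j := by
      have : k ≤ (mrank S j : ℤ) := hj
      omega
    obtain ⟨x, hx⟩ := Multiset.card_pos_iff_exists_mem.1 hpos
    obtain ⟨hxS, hxj⟩ := Multiset.mem_filter.1 hx
    exact (hm (by simpa using hxS)).trans hxj
  exact ⟨Int.csInf_mem hne hbdd, fun j hj => csInf_le hbdd hj⟩

theorem mrank_map_eq_add_card_fiber (g : ℤ → ℤ) (S : Multiset ℤ) (q : ℤ) :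
    mrank (S.map g) q =
      mrank (S.map g) (q - 1) + Multiset.card (S.filter fun i => g i = q) := by
  induction S using Multiset.induction_on with
  | empty => simp [mrank]
  | cons a S ih =>
    by_cases h : g a = q <;> simp [mrank_cons, h] <;> grind

theorem mrank_eq_add_mrank_fiber {g : ℤ → ℤ} (hg : Monotone g) (S : Multiset ℤ) (j : ℤ) :
    mrank S j = mrank (S.map g) (g j - 1) + mrank (S.filter fun i => g i = g j) j := by
  induction S using Multiset.induction_on with
  | empty => simp [mrank]
  | cons a S ih =>
    have h1 : a ≤ j → g a ≤ g j := fun h => hg h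
    have h2 : j ≤ a → g j ≤ g a := fun h => hg h
    by_cases h : g a = g j <;> simp [mrank_cons, h] <;> grind

theorem mrank_mono (S : Multiset ℤ) : Monotone (mrank S) := fun _ _ h =>
  Multiset.card_le_card (Multiset.monotone_filter_right S fun _ hx => hx.trans h)

theorem mrank_le_mrank_map {g : ℤ → ℤ} (hg : Monotone g) (S : Multiset ℤ) (j : ℤ) :
    mrank S j ≤ mrank (S.map g) (g j) := by
  rw [mrank_eq_add_mrank_fiber hg, mrank_map_eq_add_card_fiber g S (g j)]
  exact Nat.add_le_add_left (Multiset.card_le_card (Multiset.filter_le (· ≤ j) _)) _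

theorem le_mrank_iff_sub_le_mrank_fiber {g : ℤ → ℤ} (hg : Monotone g) (S : Multiset ℤ)
    {k q : ℤ} (hlt : (mrank (S.map g) (q - 1) : ℤ) < k) (hle : k ≤ (mrank (S.map g) q : ℤ))
    (j : ℤ) :
    k ≤ (mrank S j : ℤ) ↔
      k - (mrank (S.map g) (q - 1) : ℤ) ≤ (mrank (S.filter fun i => g i = q) j : ℤ) := by
  rcases lt_trichotomy (g j) q with h | rfl | h
  · have h0 : mrank (S.filter fun i => g i = q) j = 0 := by
      refine Multiset.card_eq_zero.2 (Multiset.filter_eq_nil.2 fun x hx hxj => ?_)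
      exact (hg hxj).not_gt ((Multiset.mem_filter.1 hx).2 ▸ h)
    have h1 := mrank_le_mrank_map hg S j
    have h2 := mrank_mono (S.map g) (show g j ≤ q - 1 by omega)
    omega
  · have := mrank_eq_add_mrank_fiber hg S j
    omega
  · have h0 : mrank (S.filter fun i => g i = q) j =
        Multiset.card (S.filter fun i => g i = q) := by
      refine congrArg Multiset.card (Multiset.filter_eq_self.2 fun x hx => ?_)
      exact (hg.reflect_lt ((Multiset.mem_filter.1 hx).2 ▸ h)).le
    have h1 := mrank_map_eq_add_card_fiber g S q
    have h2 := mrank_mono (S.map g) (show q ≤ g j - 1 by omega)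
    have h3 := mrank_eq_add_mrank_fiber hg S j
    omega

theorem stmt2 (g : ℤ → ℤ) (hg : GroupingFunction g) (S : Multiset ℤ) (hS : S ≠ 0)
    (k : ℤ) (hk1 : 1 ≤ k) (hk2 : k ≤ (Multiset.card S : ℤ))
    (q : ℤ) (hq : q = mselect (S.map g) k) :
    1 ≤ k - (mrank (S.map g) (q - 1) : ℤ) ∧
    k - (mrank (S.map g) (q - 1) : ℤ) ≤ (Multiset.card (S.filter fun i => g i = q) : ℤ) ∧
    mselect S k = mselect (S.filter fun i => g i = q) (k - (mrank (S.map g) (q - 1) : ℤ)) := by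
  obtain ⟨hmem, hmin⟩ := isLeast_mselect (S := S.map g) hk1 (by simpa using hk2)
  rw [← hq] at hmem hmin
  have hle : k ≤ (mrank (S.map g) q : ℤ) := hmem
  have hlt : (mrank (S.map g) (q - 1) : ℤ) < k := by
    by_contra! h
    have := hmin h
    omega
  have hfib := mrank_map_eq_add_card_fiber g S q
  refine ⟨by omega, by omega, ?_⟩
  exact congrArg sInf (Set.ext (le_mrank_iff_sub_le_mrank_fiber hg.1 S hlt hle))
end

section
/- Let S be a finite nonempty multiset of integers and let k ∈ {1,…,|S|}. Then select_S(k) = select_{⟨S⟩}(rank_{rank_S(ℤ)}(k − 1)). -/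
theorem mrank_lt_mrank {S : Multiset ℤ} {x y : ℤ} (hy : y ∈ S) (h : x < y) :
    mrank S x < mrank S y := by
  refine Multiset.card_lt_card (lt_of_le_of_ne
    (Multiset.monotone_filter_right S fun _ hi => le_trans hi h.le) fun he => ?_)
  have hmem : y ∈ S.filter (· ≤ y) := Multiset.mem_filter.2 ⟨hy, le_rfl⟩
  rw [← he, Multiset.mem_filter] at hmem
  exact absurd hmem.2 (not_le.2 h)

theorem mrank_pos {S : Multiset ℤ} {x : ℤ} (hx : x ∈ S) : 0 < mrank S x :=
  Multiset.card_pos_iff_exists_mem.2 ⟨x, Multiset.mem_filter.2 ⟨hx, le_rfl⟩⟩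

theorem exists_mem_mrank_eq {S : Multiset ℤ} {j : ℤ} (h : mrank S j ≠ 0) :
    ∃ x ∈ S, x ≤ j ∧ mrank S x = mrank S j := by
  obtain ⟨y, hy⟩ := Multiset.card_pos_iff_exists_mem.1 (Nat.pos_of_ne_zero h)
  obtain ⟨x, hx, hmax⟩ := (S.filter (· ≤ j)).toFinset.exists_max_image id
    ⟨y, Multiset.mem_toFinset.2 hy⟩
  simp only [Multiset.mem_toFinset, Multiset.mem_filter, id] at hx hmax
  refine ⟨x, hx.1, hx.2, congrArg Multiset.card (Multiset.filter_congr fun z hz => ?_)⟩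
  exact ⟨fun hzx => hzx.trans hx.2, fun hzj => hmax z ⟨hz, hzj⟩⟩

theorem mrank_injOn (S : Multiset ℤ) : Set.InjOn (mrank S) (msupp S) := by
  intro x hx y hy h
  rcases lt_trichotomy x y with hlt | heq | hlt
  · exact absurd h (mrank_lt_mrank hy hlt).ne
  · exact heq
  · exact absurd h (mrank_lt_mrank hx hlt).ne'

theorem finite_msupp (S : Multiset ℤ) : (msupp S).Finite :=
  S.toFinset.finite_toSet.subset fun _ hx => Multiset.mem_toFinset.2 hx

theorem exists_mrank_eq_zero (S : Multiset ℤ) : ∃ j : ℤ, mrank S j = 0 := by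
  by_contra! h
  obtain ⟨b, hb⟩ := (finite_msupp S).bddBelow
  obtain ⟨x, hx, hxb, -⟩ := exists_mem_mrank_eq (h (b - 1))
  have := hb hx
  omega

theorem srank_rankImage (S : Multiset ℤ) {k : ℤ} (hk : 1 ≤ k) :
    srank (rankImage S) (k - 1) = {x ∈ msupp S | (mrank S x : ℤ) < k}.ncard + 1 := by
  have himage : {i ∈ rankImage S | i ≤ k - 1} =
      insert 0 ((fun x => (mrank S x : ℤ)) '' {x ∈ msupp S | (mrank S x : ℤ) < k}) := by
    ext i
    constructor
    · rintro ⟨⟨j, rfl⟩, hj⟩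
      by_cases h : mrank S j = 0
      · exact Or.inl (by simp [h])
      · obtain ⟨x, hx, -, he⟩ := exists_mem_mrank_eq h
        refine Or.inr ⟨x, ⟨hx, ?_⟩, by simp [he]⟩
        rw [he]
        exact Int.lt_of_le_sub_one hj
    · rintro (rfl | ⟨x, ⟨-, hx⟩, rfl⟩)
      · obtain ⟨j, hj⟩ := exists_mrank_eq_zero S
        exact ⟨⟨j, by simp [hj]⟩, by omega⟩
      · exact ⟨⟨x, rfl⟩, Int.le_sub_one_of_lt hx⟩
  have hfin : {x ∈ msupp S | (mrank S x : ℤ) < k}.Finite :=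
    (finite_msupp S).subset fun _ h => h.1
  rw [srank, himage, Set.ncard_insert_of_notMem _ (hfin.image _), Set.InjOn.ncard_image]
  · intro x hx y hy h
    exact mrank_injOn S hx.1 hy.1 (Int.natCast_inj.1 h)
  · rintro ⟨x, ⟨hx, -⟩, h⟩
    have := mrank_pos (S := S) hx
    simp only at h
    omega

theorem le_mrank_iff (S : Multiset ℤ) {k : ℤ} (hk : 1 ≤ k) (j : ℤ) :
    k ≤ (mrank S j : ℤ) ↔
      (srank (rankImage S) (k - 1) : ℤ) ≤ (srank (msupp S) j : ℤ) := by
  rw [srank_rankImage S hk, Nat.cast_le, Nat.succ_le_iff, srank]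
  constructor
  · intro h
    refine Set.ncard_lt_ncard ?_ ((finite_msupp S).subset fun _ h => h.1)
    obtain ⟨x, hx, hxj, he⟩ := exists_mem_mrank_eq (S := S) (j := j) (by omega)
    refine (Set.ssubset_iff_of_subset ?_).2 ⟨x, ⟨hx, hxj⟩, fun hxk => ?_⟩
    · rintro y ⟨hy, hyk⟩
      refine ⟨hy, le_of_not_gt fun hlt => ?_⟩
      have := mrank_mono S hlt.le
      omega
    · have := hxk.2
      omega
  · intro h
    by_contra! hlt
    refine absurd h (not_lt.2 (Set.ncard_le_ncard ?_ ((finite_msupp S).subset fun _ h => h.1)))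
    rintro y ⟨hy, hyj⟩
    have := mrank_mono S hyj
    exact ⟨hy, by omega⟩

theorem stmt4 (S : Multiset ℤ) (hS : S ≠ 0)
    (k : ℤ) (hk1 : 1 ≤ k) (hk2 : k ≤ (Multiset.card S : ℤ)) :
    mselect S k = sselect (msupp S) ((srank (rankImage S) (k - 1) : ℤ)) := by
  simp only [mselect, sselect, le_mrank_iff S hk1]
end
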